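/- Let ε > 0. For Lebesgue-almost all α ∈ [0,1] the following holds: for every δ > 0 there exists N₀ (depending on α, ε, δ) such that for every integer N ≥ N₀ and every real L with N^(3/5+ε) < L ≤ N one has |∫₀¹ W(α,L,N,y)³ dy − L³| ≤ δ·L³. -/

import Mathlib

open MeasureTheory

/-- The counting function `W(α,L,N,y)`: the number of integers `1 ≤ n ≤ N` such that
the fractional part of `α·n² − y` is at most `L/N`. -/
noncomputable def W (α L : ℝ) (N : ℕ) (y : ℝ) : ℝ :=
  ((Finset.Icc 1 N).filter (fun n : ℕ => Int.fract (α * (n : ℝ)^2 - y) ≤ L / N)).card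

open Filter Topology

theorem Measurable.intervalIntegrable_of_abs_le {f : ℝ → ℝ} (hf : Measurable f) {C : ℝ}
    (hC : ∀ x, |f x| ≤ C) (a b : ℝ) : IntervalIntegrable f volume a b := by
  rw [intervalIntegrable_iff]
  exact Measure.integrableOn_of_bounded (M := C) (by simp)
    hf.aestronglyMeasurable (ae_of_all _ hC)

/-- The integral over `α` of a periodic function along `k α + y`, `k ≠ 0`, is its mean. -/
theorem Function.Periodic.integral_comp_int_mul_add {g : ℝ → ℝ} (hp : Function.Periodic g 1)
    (hg : Measurable g) {C : ℝ} (hC : ∀ x, |g x| ≤ C) {k : ℤ} (hk : k ≠ 0) (y : ℝ) :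
    ∫ α in (0:ℝ)..1, g (k * α + y) = ∫ x in (0:ℝ)..1, g x := by
  have hk' : (k : ℝ) ≠ 0 := by exact_mod_cast hk
  rw [intervalIntegral.integral_comp_mul_add g hk']
  have h := hp.intervalIntegral_add_zsmul_eq k y (hg.intervalIntegrable_of_abs_le hC)
  have h' := hp.intervalIntegral_add_eq y 0
  rw [zero_add] at h'
  rw [h', zsmul_eq_mul, zsmul_eq_mul, mul_one] at h
  rw [mul_zero, zero_add, mul_one, add_comm (k : ℝ) y, h, smul_eq_mul,
    inv_mul_cancel_left₀ hk']

/-- Distinct dilates of a mean-zero periodic function, translated by a common uniform shift,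
are uncorrelated. -/
theorem Function.Periodic.integral_correlation_eq_zero {g : ℝ → ℝ}
    (hp : Function.Periodic g 1) (hg : Measurable g) {C : ℝ} (hC : ∀ x, |g x| ≤ C)
    (h0 : ∫ x in (0:ℝ)..1, g x = 0) {a b : ℤ} (hab : a ≠ b) :
    ∫ α in (0:ℝ)..1, ∫ y in (0:ℝ)..1, g (a * α - y) * g (b * α - y) = 0 := by
  have inner (α : ℝ) : ∫ y in (0:ℝ)..1, g (a * α - y) * g (b * α - y)
      = ∫ u in (0:ℝ)..1, g u * g (((b - a : ℤ) : ℝ) * α + u) := by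
    have hper : Function.Periodic (fun u => g u * g (((b - a : ℤ) : ℝ) * α + u)) 1 := by
      intro u
      simp only [← add_assoc, hp _]
    have h1 := intervalIntegral.integral_comp_sub_left (a := 0) (b := 1)
      (fun u => g u * g (((b - a : ℤ) : ℝ) * α + u)) (a * α)
    have h2 := hper.intervalIntegral_add_eq (a * α - 1) 0
    rw [zero_add, sub_add_cancel] at h2
    rw [sub_zero, h2] at h1
    rw [← h1]
    congr 1
    ext y
    congr 2
    push_cast
    ring
  simp_rw [inner]
  have hC0 : 0 ≤ C := (abs_nonneg _).trans (hC 0)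
  have hswap : ∫ α in (0:ℝ)..1, ∫ u in (0:ℝ)..1, g u * g (((b - a : ℤ) : ℝ) * α + u)
      = ∫ u in (0:ℝ)..1, ∫ α in (0:ℝ)..1, g u * g (((b - a : ℤ) : ℝ) * α + u) := by
    simp only [intervalIntegral.integral_of_le zero_le_one]
    refine integral_integral_swap ?_
    refine Integrable.of_bound (Measurable.aestronglyMeasurable ?_) (C * C) (ae_of_all _ ?_)
    · simp only [Function.uncurry_def]
      fun_prop
    · rintro ⟨x, y⟩
      simp only [Function.uncurry_apply_pair, Real.norm_eq_abs, abs_mul]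
      gcongr <;> exact hC _
  rw [hswap]
  have hz (u : ℝ) : ∫ α in (0:ℝ)..1, g u * g (((b - a : ℤ) : ℝ) * α + u) = 0 := by
    rw [intervalIntegral.integral_const_mul,
      hp.integral_comp_int_mul_add hg hC (sub_ne_zero.mpr hab.symm), h0, mul_zero]
  simp only [hz, intervalIntegral.integral_zero]

/-- The indicator function of the arc `[0, s]` modulo one. -/
noncomputable def arcIndicator (s x : ℝ) : ℝ := if Int.fract x ≤ s then 1 else 0

theorem arcIndicator_periodic (s : ℝ) : Function.Periodic (arcIndicator s) 1 := by
  intro x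
  simp [arcIndicator]

theorem measurable_arcIndicator (s : ℝ) : Measurable (arcIndicator s) :=
  Measurable.ite (measurableSet_le measurable_fract measurable_const)
    measurable_const measurable_const

theorem arcIndicator_nonneg (s x : ℝ) : 0 ≤ arcIndicator s x := by
  unfold arcIndicator
  split_ifs <;> norm_num

theorem arcIndicator_le_one (s x : ℝ) : arcIndicator s x ≤ 1 := by
  unfold arcIndicator
  split_ifs <;> norm_num

theorem abs_arcIndicator_le_one (s x : ℝ) : |arcIndicator s x| ≤ 1 := by
  rw [abs_of_nonneg (arcIndicator_nonneg s x)]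
  exact arcIndicator_le_one s x

theorem intervalIntegrable_arcIndicator (s a b : ℝ) :
    IntervalIntegrable (arcIndicator s) volume a b :=
  (measurable_arcIndicator s).intervalIntegrable_of_abs_le (abs_arcIndicator_le_one s) a b

theorem integral_arcIndicator_floor {s : ℝ} (hs : 0 ≤ s) (hs1 : s ≤ 1) (k : ℤ) :
    ∫ x in (k : ℝ)..k + s, arcIndicator s x = s := by
  rw [intervalIntegral.integral_congr_Ioo_of_le (g := fun _ => (1 : ℝ)) (by linarith)]
  · simp
  · rintro x ⟨hx0, hx1⟩
    have : ⌊x⌋ = k := Int.floor_eq_iff.mpr ⟨hx0.le, by linarith⟩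
    have hx : Int.fract x ≤ s := by
      rw [Int.fract, this]
      linarith
    simp [arcIndicator, hx]

theorem integral_arcIndicator {s : ℝ} (hs : 0 ≤ s) (hs1 : s ≤ 1) :
    ∫ x in (0:ℝ)..1, arcIndicator s x = s := by
  have h := intervalIntegral.integral_add_adjacent_intervals
    (intervalIntegrable_arcIndicator s 0 s) (intervalIntegrable_arcIndicator s s 1)
  have h1 := integral_arcIndicator_floor hs hs1 0
  have h2 : ∫ x in s..1, arcIndicator s x = 0 := by
    rw [intervalIntegral.integral_congr_Ioo_of_le (g := fun _ => (0 : ℝ)) hs1]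
    · simp
    · rintro x ⟨hx0, hx1⟩
      have hx : ¬ Int.fract x ≤ s := by
        rw [Int.fract_eq_self.mpr ⟨by linarith, hx1⟩]
        linarith
      simp [arcIndicator, hx]
  rw [Int.cast_zero, zero_add] at h1
  rw [← h, h1, h2, add_zero]

/-- A short arc swept inside a longer one. -/
theorem integral_arcIndicator_sweep_le {s S : ℝ} (hs : 0 ≤ s) (hsS : s ≤ S) (hS : S ≤ 1)
    (x y : ℝ) :
    ∫ z in y..y + (S - s), arcIndicator s (x - z) ≤ s * arcIndicator S (x - y) := by
  rw [intervalIntegral.integral_comp_sub_left]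
  set r := x - y with hr
  have hr' : x - (y + (S - s)) = r - (S - s) := by rw [hr]; ring
  rw [hr']
  by_cases h : Int.fract r ≤ S
  · have h1 := intervalIntegral.integral_mono_interval (f := arcIndicator s)
      (c := r - (S - s)) (d := r - (S - s) + 1) (μ := volume) le_rfl
      (by linarith : r - (S - s) ≤ r) (by linarith)
      (ae_of_all _ (arcIndicator_nonneg s)) (intervalIntegrable_arcIndicator s _ _)
    rw [(arcIndicator_periodic s).intervalIntegral_add_eq _ 0, zero_add,
      integral_arcIndicator hs (hsS.trans hS)] at h1
    rw [arcIndicator, if_pos h, mul_one]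
    exact h1
  · rw [arcIndicator, if_neg h, mul_zero]
    rw [intervalIntegral.integral_congr_Ioo_of_le (g := fun _ => (0 : ℝ)) (by linarith)]
    · simp
    · rintro u ⟨hu0, hu1⟩
      have hfr := Int.floor_add_fract r
      have hlt := Int.fract_lt_one r
      have : ⌊u⌋ = ⌊r⌋ := Int.floor_eq_iff.mpr ⟨by linarith, by linarith⟩
      have hx : ¬ Int.fract u ≤ s := by
        rw [Int.fract, this]
        linarith
      simp [arcIndicator, hx]

/-- A short arc swept across a longer one. -/
theorem le_integral_arcIndicator_sweep {s S : ℝ} (hs : 0 ≤ s) (hs1 : s ≤ 1) (hS : 0 ≤ S)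
    (x y : ℝ) :
    s * arcIndicator S (x - y) ≤ ∫ z in (y - s)..(y + S), arcIndicator s (x - z) := by
  rw [intervalIntegral.integral_comp_sub_left]
  by_cases h : Int.fract (x - y) ≤ S
  · have hfr := Int.floor_add_fract (x - y)
    have h0 := Int.fract_nonneg (x - y)
    have h1 := intervalIntegral.integral_mono_interval (f := arcIndicator s)
      (a := (⌊x - y⌋ : ℝ)) (b := ⌊x - y⌋ + s)
      (c := x - (y + S)) (d := x - (y - s)) (μ := volume)
      (by linarith) (by linarith) (by linarith)
      (ae_of_all _ (arcIndicator_nonneg s)) (intervalIntegrable_arcIndicator s _ _)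
    rw [integral_arcIndicator_floor hs hs1] at h1
    rwa [arcIndicator, if_pos h, mul_one]
  · rw [arcIndicator, if_neg h, mul_zero]
    exact intervalIntegral.integral_nonneg (by linarith) fun u _ => arcIndicator_nonneg s u

/-- The number of `1 ≤ n ≤ N` with `α n²` in the arc `[y, y + s]` modulo one. -/
noncomputable def arcCount (s : ℝ) (N : ℕ) (α y : ℝ) : ℝ :=
  ∑ n ∈ Finset.Icc 1 N, arcIndicator s (α * (n : ℝ) ^ 2 - y)

theorem W_eq_arcCount (α L : ℝ) (N : ℕ) (y : ℝ) : W α L N y = arcCount (L / N) N α y := by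
  simp only [W, arcCount, arcIndicator]
  rw [Finset.card_filter]
  push_cast
  rfl

theorem arcCount_mono (s : ℝ) {M N : ℕ} (h : M ≤ N) (α y : ℝ) :
    arcCount s M α y ≤ arcCount s N α y :=
  Finset.sum_le_sum_of_subset_of_nonneg (Finset.Icc_subset_Icc_right h)
    fun _ _ _ => arcIndicator_nonneg _ _

theorem measurable_arcCount (s : ℝ) (N : ℕ) :
    Measurable fun p : ℝ × ℝ => arcCount s N p.1 p.2 :=
  Finset.measurable_sum _ fun n _ => (measurable_arcIndicator s).comp (by fun_prop)

theorem arcCount_periodic (s : ℝ) (N : ℕ) (α : ℝ) :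
    Function.Periodic (arcCount s N α) 1 := by
  intro y
  refine Finset.sum_congr rfl fun n _ => ?_
  rw [← sub_sub, (arcIndicator_periodic s).sub_eq]

theorem arcCount_nonneg (s : ℝ) (N : ℕ) (α y : ℝ) : 0 ≤ arcCount s N α y :=
  Finset.sum_nonneg fun _ _ => arcIndicator_nonneg _ _

theorem arcCount_le (s : ℝ) (N : ℕ) (α y : ℝ) : arcCount s N α y ≤ N := by
  refine (Finset.sum_le_card_nsmul _ _ 1 fun _ _ => arcIndicator_le_one _ _).trans ?_
  simp

theorem abs_arcCount_le (s : ℝ) (N : ℕ) (α y : ℝ) : |arcCount s N α y| ≤ N := by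
  rw [abs_of_nonneg (arcCount_nonneg s N α y)]
  exact arcCount_le s N α y

/-- The variance in the shift `y` of the counting function. -/
noncomputable def arcVariance (s : ℝ) (N : ℕ) (α : ℝ) : ℝ :=
  ∫ y in (0:ℝ)..1, (arcCount s N α y - s * N) ^ 2

theorem arcVariance_nonneg (s : ℝ) (N : ℕ) (α : ℝ) : 0 ≤ arcVariance s N α :=
  intervalIntegral.integral_nonneg zero_le_one fun _ _ => sq_nonneg _

theorem integrable_sq_arcCount_sub (s : ℝ) (N : ℕ) (μ : Measure (ℝ × ℝ)) [IsFiniteMeasure μ] :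
    Integrable (fun p : ℝ × ℝ => (arcCount s N p.1 p.2 - s * N) ^ 2) μ := by
  refine Integrable.of_bound
    (((measurable_arcCount s N).sub_const _).pow_const 2).aestronglyMeasurable
    ((N + |s * N|) ^ 2) (ae_of_all _ fun p => ?_)
  rw [Real.norm_eq_abs, abs_pow]
  gcongr
  exact (abs_sub _ _).trans (by gcongr; exact abs_arcCount_le s N p.1 p.2)

theorem integrable_arcVariance (s : ℝ) (N : ℕ) :
    Integrable (arcVariance s N) (volume.restrict (Set.Ioc (0:ℝ) 1)) := by
  have h := (integrable_sq_arcCount_sub s N ((volume.restrict (Set.Ioc (0:ℝ) 1)).prod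
    (volume.restrict (Set.Ioc (0:ℝ) 1)))).integral_prod_left
  refine h.congr (ae_of_all _ fun α => ?_)
  simp only [arcVariance, intervalIntegral.integral_of_le zero_le_one]

theorem integral_arcVariance_le {s : ℝ} (hs : 0 ≤ s) (hs1 : s ≤ 1) (N : ℕ) :
    ∫ α in (0:ℝ)..1, arcVariance s N α ≤ s * N := by
  set g : ℝ → ℝ := fun x => arcIndicator s x - s with hg
  have hgp : Function.Periodic g 1 := fun x => by simp only [hg, arcIndicator_periodic s x]
  have hgm : Measurable g := (measurable_arcIndicator s).sub_const s
  have hgb (x : ℝ) : |g x| ≤ 1 := by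
    rw [abs_le]
    constructor <;> linarith [arcIndicator_nonneg s x, arcIndicator_le_one s x]
  have hg0 : ∫ x in (0:ℝ)..1, g x = 0 := by
    rw [intervalIntegral.integral_sub (intervalIntegrable_arcIndicator s 0 1) (by simp),
      integral_arcIndicator hs hs1]
    simp
  have hsum (α y : ℝ) : (arcCount s N α y - s * N) ^ 2 = ∑ n ∈ Finset.Icc 1 N,
      ∑ m ∈ Finset.Icc 1 N, g (((n ^ 2 : ℤ) : ℝ) * α - y) * g (((m ^ 2 : ℤ) : ℝ) * α - y) := by
    have : arcCount s N α y - s * N = ∑ n ∈ Finset.Icc 1 N, g (((n ^ 2 : ℤ) : ℝ) * α - y) := by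
      simp only [hg, Finset.sum_sub_distrib, arcCount]
      simp [mul_comm]
    rw [this, sq, Finset.sum_mul_sum]
  have hint (a b : ℤ) : Integrable (fun p : ℝ × ℝ => g (a * p.1 - p.2) * g (b * p.1 - p.2))
      ((volume.restrict (Set.Ioc (0:ℝ) 1)).prod (volume.restrict (Set.Ioc (0:ℝ) 1))) := by
    refine Integrable.of_bound (Measurable.aestronglyMeasurable (by fun_prop)) (1 * 1)
      (ae_of_all _ fun p => ?_)
    rw [Real.norm_eq_abs, abs_mul]
    gcongr <;> exact hgb _
  have hdiag (a : ℤ) :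
      ∫ α in (0:ℝ)..1, ∫ y in (0:ℝ)..1, g (a * α - y) * g (a * α - y) ≤ s := by
    have inner (α : ℝ) : ∫ y in (0:ℝ)..1, g (a * α - y) * g (a * α - y) ≤ s := by
      have h1 := intervalIntegral.integral_comp_sub_left (a := 0) (b := 1)
        (fun u => g u * g u) (a * α)
      have hper : Function.Periodic (fun u => g u * g u) 1 := fun u => by simp only [hgp u]
      have h2 := hper.intervalIntegral_add_eq (a * α - 1) 0
      rw [zero_add, sub_add_cancel] at h2
      rw [sub_zero, h2] at h1
      rw [h1]
      have h3 (u : ℝ) : g u * g u = (1 - 2 * s) * arcIndicator s u + s ^ 2 := by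
        simp only [hg, arcIndicator]
        split_ifs <;> ring
      simp_rw [h3]
      rw [intervalIntegral.integral_add ((intervalIntegrable_arcIndicator s 0 1).const_mul _)
        (by simp), intervalIntegral.integral_const_mul, integral_arcIndicator hs hs1]
      simp only [intervalIntegral.integral_const, smul_eq_mul]
      nlinarith
    have h4 : IntervalIntegrable (fun α : ℝ => ∫ y in (0:ℝ)..1, g (a * α - y) * g (a * α - y))
        volume 0 1 := by
      rw [intervalIntegrable_iff_integrableOn_Ioc_of_le zero_le_one]
      simp only [intervalIntegral.integral_of_le zero_le_one]
      exact (hint a a).integral_prod_left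
    have h5 := intervalIntegral.integral_mono_on zero_le_one h4
      (intervalIntegrable_const (c := s)) fun α _ => inner α
    simpa using h5
  have hprod (a b : ℤ) : ∫ p, g (a * p.1 - p.2) * g (b * p.1 - p.2)
      ∂((volume.restrict (Set.Ioc (0:ℝ) 1)).prod (volume.restrict (Set.Ioc (0:ℝ) 1)))
      = ∫ α in (0:ℝ)..1, ∫ y in (0:ℝ)..1, g (a * α - y) * g (b * α - y) := by
    rw [integral_prod _ (hint a b)]
    simp only [intervalIntegral.integral_of_le zero_le_one]
  have hV : ∫ α in (0:ℝ)..1, arcVariance s N α = ∑ n ∈ Finset.Icc 1 N, ∑ m ∈ Finset.Icc 1 N,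
      ∫ α in (0:ℝ)..1, ∫ y in (0:ℝ)..1,
        g (((n ^ 2 : ℤ) : ℝ) * α - y) * g (((m ^ 2 : ℤ) : ℝ) * α - y) := by
    simp only [← hprod]
    simp only [arcVariance, intervalIntegral.integral_of_le zero_le_one]
    rw [← integral_prod _ (integrable_sq_arcCount_sub s N _)]
    simp only [hsum]
    rw [integral_finsetSum _ fun n _ => integrable_finsetSum _ fun m _ => hint _ _]
    refine Finset.sum_congr rfl fun n _ => ?_
    rw [integral_finsetSum _ fun m _ => hint _ _]
  rw [hV]
  have hrow : ∀ n ∈ Finset.Icc 1 N, ∑ m ∈ Finset.Icc 1 N,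
      ∫ α in (0:ℝ)..1, ∫ y in (0:ℝ)..1,
        g (((n ^ 2 : ℤ) : ℝ) * α - y) * g (((m ^ 2 : ℤ) : ℝ) * α - y) ≤ s := by
    intro n hn
    rw [Finset.sum_eq_single n]
    · exact hdiag _
    · intro m _ hmn
      refine hgp.integral_correlation_eq_zero hgm hgb hg0 fun h => hmn ?_
      have h' : n ^ 2 = m ^ 2 := by exact_mod_cast h
      exact (Nat.pow_left_injective two_ne_zero h').symm
    · exact fun h => absurd hn h
  refine (Finset.sum_le_card_nsmul _ _ s hrow).trans ?_
  simp [mul_comm]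

theorem intervalIntegrable_arcCount (s : ℝ) (N : ℕ) (α a b : ℝ) :
    IntervalIntegrable (arcCount s N α) volume a b :=
  ((measurable_arcCount s N).comp measurable_prodMk_left).intervalIntegrable_of_abs_le
    (abs_arcCount_le s N α) a b

theorem intervalIntegrable_arcIndicator_sub (s x a b : ℝ) :
    IntervalIntegrable (fun z => arcIndicator s (x - z)) volume a b :=
  ((measurable_arcIndicator s).comp (measurable_const.sub measurable_id)).intervalIntegrable_of_abs_le
    (fun _ => abs_arcIndicator_le_one s _) a b

theorem integral_arcCount (s : ℝ) (N : ℕ) (α a b : ℝ) :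
    ∫ z in a..b, arcCount s N α z
      = ∑ n ∈ Finset.Icc 1 N, ∫ z in a..b, arcIndicator s (α * (n : ℝ) ^ 2 - z) :=
  intervalIntegral.integral_finsetSum fun _ _ => intervalIntegrable_arcIndicator_sub s _ a b

theorem integral_arcCount_le {s S : ℝ} (hs : 0 ≤ s) (hsS : s ≤ S) (hS : S ≤ 1)
    (N : ℕ) (α y : ℝ) :
    ∫ z in y..y + (S - s), arcCount s N α z ≤ s * arcCount S N α y := by
  rw [integral_arcCount, arcCount, Finset.mul_sum]
  exact Finset.sum_le_sum fun _ _ => integral_arcIndicator_sweep_le hs hsS hS _ _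

theorem le_integral_arcCount {s S : ℝ} (hs : 0 ≤ s) (hs1 : s ≤ 1) (hS : 0 ≤ S)
    (N : ℕ) (α y : ℝ) :
    s * arcCount S N α y ≤ ∫ z in (y - s)..(y + S), arcCount s N α z := by
  rw [integral_arcCount, arcCount, Finset.mul_sum]
  exact Finset.sum_le_sum fun _ _ => le_integral_arcIndicator_sweep hs hs1 hS _ _

/-- Local mean deviation of the counting function in terms of its variance. -/
theorem abs_integral_arcCount_sub_le (s : ℝ) (N : ℕ) (α : ℝ) {a b c : ℝ} (hab : a ≤ b)
    (hb : b ≤ a + 2) (hc : 0 < c) :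
    |(∫ z in a..b, arcCount s N α z) - s * N * (b - a)|
      ≤ c / 2 * (b - a) + arcVariance s N α / c := by
  set D : ℝ → ℝ := fun z => arcCount s N α z - s * N with hD
  have hDp : Function.Periodic (fun z => D z ^ 2) 1 := fun z => by
    simp only [hD, arcCount_periodic s N α z]
  have hDm : Measurable D := ((measurable_arcCount s N).comp measurable_prodMk_left).sub_const _
  have hDb (z : ℝ) : |D z| ≤ N + |s * N| :=
    (abs_sub _ _).trans (by gcongr; exact abs_arcCount_le s N α z)
  have hDi := hDm.intervalIntegrable_of_abs_le hDb
  have hD2 (u v : ℝ) : IntervalIntegrable (fun z => D z ^ 2) volume u v :=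
    (hDm.pow_const 2).intervalIntegrable_of_abs_le (C := (N + |s * N|) ^ 2)
      (fun z => by rw [abs_pow]; gcongr; exact hDb z) u v
  have hper (u : ℝ) : ∫ z in u..u + 1, D z ^ 2 = arcVariance s N α := by
    rw [hDp.intervalIntegral_add_eq u 0, zero_add]
    rfl
  have hsq : ∫ z in a..b, D z ^ 2 ≤ 2 * arcVariance s N α := by
    have h1 := intervalIntegral.integral_mono_interval (f := fun z => D z ^ 2) (μ := volume)
      le_rfl hab hb (ae_of_all _ fun z => sq_nonneg (D z)) (hD2 _ _)
    have h2 := intervalIntegral.integral_add_adjacent_intervals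
      (hD2 a (a + 1)) (hD2 (a + 1) (a + 1 + 1))
    rw [hper, hper, add_assoc a, one_add_one_eq_two] at h2
    linarith
  have hmean : (∫ z in a..b, arcCount s N α z) - s * N * (b - a) = ∫ z in a..b, D z := by
    rw [intervalIntegral.integral_sub (intervalIntegrable_arcCount s N α a b) (by simp),
      intervalIntegral.integral_const, smul_eq_mul, mul_comm (b - a)]
  rw [hmean]
  calc |∫ z in a..b, D z| ≤ ∫ z in a..b, |D z| :=
        intervalIntegral.abs_integral_le_integral_abs hab
    _ ≤ ∫ z in a..b, (c / 2 + 1 / (2 * c) * D z ^ 2) := by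
        refine intervalIntegral.integral_mono_on hab (hDi a b).abs
          ((intervalIntegrable_const).add ((hD2 a b).const_mul _)) fun z _ => ?_
        have h : c / 2 + 1 / (2 * c) * D z ^ 2 - |D z| = (c - |D z|) ^ 2 / (2 * c) := by
          rw [← sq_abs (D z)]
          field_simp
          ring
        have : 0 ≤ (c - |D z|) ^ 2 / (2 * c) := by positivity
        linarith
    _ = c / 2 * (b - a) + 1 / (2 * c) * ∫ z in a..b, D z ^ 2 := by
        rw [intervalIntegral.integral_add intervalIntegrable_const ((hD2 a b).const_mul _),
          intervalIntegral.integral_const_mul, intervalIntegral.integral_const, smul_eq_mul,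
          mul_comm (b - a)]
    _ ≤ c / 2 * (b - a) + 1 / (2 * c) * (2 * arcVariance s N α) := by gcongr
    _ = c / 2 * (b - a) + arcVariance s N α / c := by field_simp

/-- A small variance at scale `s` controls the count in every arc much longer than `s`. -/
theorem abs_arcCount_sub_le {s S δ : ℝ} {N : ℕ} {α : ℝ} (hs : 0 < s) (hδ : 0 < δ) (hδ1 : δ ≤ 1)
    (hsS : s ≤ δ * S) (hS : S ≤ 1) (hN : 0 < N)
    (hV : arcVariance s N α ≤ δ ^ 2 * (s ^ 3 * N ^ 2)) (y : ℝ) :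
    |arcCount S N α y - S * N| ≤ 3 * δ * (S * N) := by
  have hN' : (0 : ℝ) < N := by exact_mod_cast hN
  have hS0 : 0 < S := pos_of_mul_pos_right (hs.trans_le hsS) hδ.le
  have hsS' : s ≤ S := hsS.trans (by nlinarith)
  have hc : 0 < δ * s * N := by positivity
  have hVc : arcVariance s N α / (δ * s * N) ≤ s * (δ * s * N) := by
    rw [div_le_iff₀ hc]
    exact hV.trans_eq (by ring)
  have h1 := (abs_le.mp (abs_integral_arcCount_sub_le s N α
    (a := y) (b := y + (S - s)) (by linarith) (by linarith) hc)).1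
  have h2 := (abs_le.mp (abs_integral_arcCount_sub_le s N α
    (a := y - s) (b := y + S) (by linarith) (by linarith) hc)).2
  have h3 := integral_arcCount_le hs.le hsS' hS N α y
  have h4 := le_integral_arcCount hs.le (hsS'.trans hS) hS0.le N α y
  have hsN : s * N ≤ δ * (S * N) := by nlinarith
  have hδsN : δ * (s * N) ≤ δ * (S * N) := by gcongr
  have lower : s * (S * N - 3 * δ * (S * N)) ≤ s * arcCount S N α y := by
    have e : s * (S * N - s * N - δ * (S * N) / 2 - δ * (s * N)) ≤ s * arcCount S N α y := by
      have : 0 ≤ δ * s * N / 2 * s := by positivity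
      linarith
    refine le_trans (mul_le_mul_of_nonneg_left ?_ hs.le) e
    linarith [show 0 ≤ δ * (S * N) by positivity]
  have upper : s * arcCount S N α y ≤ s * (S * N + 3 * δ * (S * N)) := by
    have e : s * arcCount S N α y
        ≤ s * (S * N + s * N + δ * (S * N) / 2 + δ * (s * N) / 2 + δ * (s * N)) := by
      linarith
    refine e.trans (mul_le_mul_of_nonneg_left ?_ hs.le)
    linarith
  have l := le_of_mul_le_mul_left lower hs
  have u := le_of_mul_le_mul_left upper hs
  rw [abs_le]
  constructor <;> linarith

/-- If `∑ 1 / (s_j ^ 2 N_j)` converges, the variance is almost surely `o (s_j ^ 3 N_j ^ 2)`. -/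
theorem ae_tendsto_arcVariance_div {s : ℕ → ℝ} {N : ℕ → ℕ} (hs : ∀ j, 0 < s j)
    (hs1 : ∀ j, s j ≤ 1) (hN : ∀ j, 0 < N j) (hsum : Summable fun j => 1 / (s j ^ 2 * N j)) :
    ∀ᵐ α ∂(volume.restrict (Set.Icc (0:ℝ) 1)),
      Tendsto (fun j => arcVariance (s j) (N j) α / (s j ^ 3 * N j ^ 2)) atTop (𝓝 0) := by
  rw [← restrict_Ioc_eq_restrict_Icc]
  have hQ0 (j : ℕ) (α : ℝ) : 0 ≤ arcVariance (s j) (N j) α / (s j ^ 3 * N j ^ 2) :=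
    div_nonneg (arcVariance_nonneg _ _ _) (mul_nonneg (pow_nonneg (hs j).le 3) (sq_nonneg _))
  have hQi (j : ℕ) : Integrable (fun α => arcVariance (s j) (N j) α / (s j ^ 3 * N j ^ 2))
      (volume.restrict (Set.Ioc (0:ℝ) 1)) :=
    (integrable_arcVariance _ _).div_const _
  have hQl (j : ℕ) :
      ∫⁻ α in Set.Ioc (0:ℝ) 1, ENNReal.ofReal (arcVariance (s j) (N j) α / (s j ^ 3 * N j ^ 2))
        ≤ ENNReal.ofReal (1 / (s j ^ 2 * N j)) := by
    rw [← ofReal_integral_eq_lintegral_ofReal (hQi j) (ae_of_all _ (hQ0 j))]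
    refine ENNReal.ofReal_le_ofReal ?_
    have h := integral_arcVariance_le (hs j).le (hs1 j) (N j)
    rw [intervalIntegral.integral_of_le zero_le_one] at h
    have hsj := hs j
    have hNj : (0 : ℝ) < N j := by exact_mod_cast hN j
    rw [integral_div, div_le_iff₀ (by positivity)]
    refine h.trans_eq ?_
    field_simp
  have hmeas (j : ℕ) :
      AEMeasurable (fun α => ENNReal.ofReal (arcVariance (s j) (N j) α / (s j ^ 3 * N j ^ 2)))
        (volume.restrict (Set.Ioc (0:ℝ) 1)) := (hQi j).aemeasurable.ennreal_ofReal
  have hfin : ∫⁻ α in Set.Ioc (0:ℝ) 1,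
      ∑' j, ENNReal.ofReal (arcVariance (s j) (N j) α / (s j ^ 3 * N j ^ 2)) ≠ ⊤ := by
    rw [lintegral_tsum hmeas]
    exact ne_top_of_le_ne_top hsum.tsum_ofReal_ne_top (ENNReal.tsum_le_tsum hQl)
  filter_upwards [ae_lt_top' (AEMeasurable.tsum hmeas) hfin] with α hα
  have h := ENNReal.tendsto_atTop_zero_of_tsum_ne_top hα.ne
  have h' := (ENNReal.tendsto_toReal ENNReal.zero_ne_top).comp h
  simpa [Function.comp_def, ENNReal.toReal_ofReal (hQ0 _ _)] using h'

theorem Nat.exists_pow_le_and_lt_succ_pow (N : ℕ) {d : ℕ} (hd : d ≠ 0) :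
    ∃ j : ℕ, j ^ d ≤ N ∧ N < (j + 1) ^ d := by
  have hex : ∃ j : ℕ, N < (j + 1) ^ d :=
    ⟨N, (Nat.lt_succ_self N).trans_le (Nat.le_self_pow hd _)⟩
  refine ⟨Nat.find hex, ?_, Nat.find_spec hex⟩
  rcases h : Nat.find hex with _ | k
  · simp [hd]
  · exact not_lt.mp (Nat.find_min hex (h ▸ Nat.lt_succ_self k))

theorem eventually_succ_pow_le_mul_pow {δ : ℝ} (hδ : 0 < δ) (d : ℕ) :
    ∀ᶠ j : ℕ in atTop, ((j + 1 : ℕ) : ℝ) ^ d ≤ (1 + δ) * (j : ℝ) ^ d := by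
  have h : Tendsto (fun j : ℕ => (1 + 1 / (j : ℝ)) ^ d) atTop (𝓝 1) := by
    have := ((tendsto_const_nhds (x := (1 : ℝ))).add tendsto_one_div_atTop_nhds_zero_nat).pow d
    simpa using this
  filter_upwards [h.eventually_le_const (show (1 : ℝ) < 1 + δ by linarith),
    eventually_gt_atTop 0] with j hj hj0
  have hj0' : (0 : ℝ) < j := by exact_mod_cast hj0
  have e : ((j + 1 : ℕ) : ℝ) = (1 + 1 / (j : ℝ)) * j := by
    push_cast
    field_simp
  rw [e, mul_pow]
  gcongr

theorem one_div_pow_le_mul_div {ε δ L : ℝ} {i j N : ℕ} (hδ : 0 < δ) (hN : 0 < N)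
    (hNj : N < (j + 1) ^ 10) (hij : j + 1 ≤ 2 * i) (hε : 16 / δ ≤ (N : ℝ) ^ ε)
    (hL : (N : ℝ) ^ ((3:ℝ)/5 + ε) < L) :
    1 / (i : ℝ) ^ 4 ≤ δ * (L / N) := by
  have hN' : (0 : ℝ) < N := by exact_mod_cast hN
  have hi : (0 : ℝ) < i := by exact_mod_cast (by lia : 0 < i)
  have h1 : (N : ℝ) ^ ((2:ℝ)/5) ≤ 16 * (i : ℝ) ^ 4 := by
    calc (N : ℝ) ^ ((2:ℝ)/5) ≤ ((2 * i : ℝ) ^ 10) ^ ((2:ℝ)/5) := by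
          refine Real.rpow_le_rpow hN'.le ?_ (by norm_num)
          exact_mod_cast hNj.le.trans (Nat.pow_le_pow_left hij 10)
      _ = (2 * i : ℝ) ^ 4 := by
          rw [← Real.rpow_natCast, ← Real.rpow_mul (by positivity), ← Real.rpow_natCast]
          norm_num
      _ = 16 * (i : ℝ) ^ 4 := by ring
  have h2 : (N : ℝ) ^ ((3:ℝ)/5 + ε) * (N : ℝ) ^ ((2:ℝ)/5) = N * (N : ℝ) ^ ε := by
    nth_rw 3 [← Real.rpow_one (N : ℝ)]
    rw [← Real.rpow_add hN', ← Real.rpow_add hN']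
    congr 1
    ring
  have h3 : N * (16 / δ) ≤ L * (16 * (i : ℝ) ^ 4) := by
    calc N * (16 / δ) ≤ N * (N : ℝ) ^ ε := by gcongr
      _ = _ := h2.symm
      _ ≤ L * (16 * (i : ℝ) ^ 4) :=
          mul_le_mul hL.le h1 (by positivity) ((Real.rpow_nonneg hN'.le _).trans hL.le)
  rw [div_le_iff₀ (by positivity)]
  have h4 : δ * (N * (16 / δ)) ≤ δ * (L * (16 * (i : ℝ) ^ 4)) := by gcongr
  rw [show δ * (N * (16 / δ)) = 16 * N by field_simp] at h4
  rw [show δ * (L / N) * (i : ℝ) ^ 4 = δ * (L * i ^ 4) / N by ring, le_div_iff₀ hN']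
  linarith

theorem third_moment_three_fifths_threshold (ε : ℝ) (hε : 0 < ε) :
    ∀ᵐ α ∂(volume.restrict (Set.Icc (0:ℝ) 1)),
      ∀ δ : ℝ, 0 < δ → ∃ N₀ : ℕ, ∀ N : ℕ, N₀ ≤ N → ∀ L : ℝ,
        (N : ℝ) ^ ((3:ℝ)/5 + ε) < L → L ≤ (N : ℝ) →
        |(∫ y in (0:ℝ)..1, (W α L N y)^3) - L^3| ≤ δ * L^3 := by
  have hsum : Summable fun j : ℕ =>
      1 / ((1 / ((j + 1 : ℕ) : ℝ) ^ 4) ^ 2 * (((j + 1) ^ 10 : ℕ) : ℝ)) := by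
    refine ((summable_nat_add_iff (f := fun j : ℕ => 1 / (j : ℝ) ^ 2) 1).mpr
      (Real.summable_one_div_nat_pow.mpr one_lt_two)).congr fun j => ?_
    rw [Nat.cast_pow]
    field_simp
  have hae := ae_tendsto_arcVariance_div (s := fun j => 1 / ((j + 1 : ℕ) : ℝ) ^ 4)
    (N := fun j => (j + 1) ^ 10) (fun j => by positivity)
    (fun j => div_le_one_of_le₀ (one_le_pow₀ (by exact_mod_cast Nat.le_add_left 1 j))
      (by positivity)) (fun j => by positivity) hsum
  filter_upwards [hae] with α hα δ₀ hδ₀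
  obtain ⟨δ, hδ, hδ1, hδδ₀⟩ : ∃ δ : ℝ, 0 < δ ∧ δ ≤ 1 ∧ 511 * δ ≤ δ₀ :=
    ⟨min 1 (δ₀ / 511), by positivity, min_le_left _ _, by
      linarith [min_le_right 1 (δ₀ / 511)]⟩
  obtain ⟨J, hJ⟩ := eventually_atTop.mp
    ((hα.eventually_le_const (show (0 : ℝ) < δ ^ 2 by positivity)).and
      (eventually_succ_pow_le_mul_pow hδ 10))
  obtain ⟨N₁, hN₁⟩ := eventually_atTop.mp
    (((tendsto_rpow_atTop hε).comp tendsto_natCast_atTop_atTop).eventually_ge_atTop (16 / δ))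
  refine ⟨max N₁ ((J + 2) ^ 10), fun N hN L hL hLN => ?_⟩
  obtain ⟨j, hjN, hNj⟩ := Nat.exists_pow_le_and_lt_succ_pow N (d := 10) (by norm_num)
  have hJj : J + 1 ≤ j := by
    have : J + 2 < j + 1 :=
      lt_of_pow_lt_pow_left₀ 10 (Nat.zero_le _) (((le_max_right _ _).trans hN).trans_lt hNj)
    lia
  have hN0 : 0 < N := lt_of_lt_of_le (by positivity) ((le_max_right _ _).trans hN)
  have hN' : (0 : ℝ) < N := by exact_mod_cast hN0
  have hNε : 16 / δ ≤ (N : ℝ) ^ ε := hN₁ N ((le_max_left _ _).trans hN)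
  have hL0 : 0 < L := (Real.rpow_pos_of_pos hN' _).trans hL
  have hLN1 : L / N ≤ 1 := (div_le_one hN').mpr hLN
  have key (i : ℕ) (hi : J + 1 ≤ i) (hij : j + 1 ≤ 2 * i) (y : ℝ) :
      |arcCount (L / N) (i ^ 10) α y - L / N * (i : ℝ) ^ 10|
        ≤ 3 * δ * (L / N * (i : ℝ) ^ 10) := by
    obtain ⟨k, rfl⟩ : ∃ k, i = k + 1 := ⟨i - 1, by lia⟩
    have hV := (hJ k (by lia)).1
    rw [div_le_iff₀ (by positivity)] at hV
    have := abs_arcCount_sub_le (by positivity) hδ hδ1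
      (one_div_pow_le_mul_div hδ hN0 hNj hij hNε hL) hLN1 (by positivity) hV y
    rwa [Nat.cast_pow] at this
  have hratio := (hJ j (by lia)).2
  have hjN' : (j : ℝ) ^ 10 ≤ N := by exact_mod_cast hjN
  have hNj' : (N : ℝ) ≤ ((j + 1 : ℕ) : ℝ) ^ 10 := by exact_mod_cast hNj.le
  have hW (y : ℝ) : |W α L N y - L| ≤ 7 * δ * L := by
    rw [W_eq_arcCount]
    have h1 := (abs_le.mp (key j (by lia) (by lia) y)).1
    have h2 := (abs_le.mp (key (j + 1) (by lia) (by lia) y)).2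
    have h3 := arcCount_mono (L / N) hjN α y
    have h4 := arcCount_mono (L / N) hNj.le α y
    have h5 : L / N * ((j + 1 : ℕ) : ℝ) ^ 10 ≤ (1 + δ) * L := by
      calc L / N * ((j + 1 : ℕ) : ℝ) ^ 10 ≤ L / N * ((1 + δ) * N) := by
            gcongr
            exact hratio.trans (by gcongr)
        _ = (1 + δ) * L := by field_simp
    have h6 : L ≤ (1 + δ) * (L / N * (j : ℝ) ^ 10) := by
      calc L = L / N * N := by field_simp
        _ ≤ L / N * ((1 + δ) * (j : ℝ) ^ 10) := by
            gcongr
            exact hNj'.trans hratio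
        _ = _ := by ring
    have h7 : L / N * (j : ℝ) ^ 10 ≤ L := by
      calc L / N * (j : ℝ) ^ 10 ≤ L / N * N := by gcongr
        _ = L := by field_simp
    rw [abs_le]
    constructor
    · nlinarith
    · nlinarith [mul_le_mul_of_nonneg_left h5 hδ.le, mul_le_mul_of_nonneg_right hδ1 hL0.le,
        mul_le_mul_of_nonneg_left (mul_le_mul_of_nonneg_right hδ1 hL0.le) hδ.le]
  have hcube (y : ℝ) : |W α L N y ^ 3 - L ^ 3| ≤ 511 * δ * L ^ 3 := by
    have h0 : 0 ≤ W α L N y := by rw [W_eq_arcCount]; exact arcCount_nonneg _ _ _ _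
    have h8 : W α L N y ≤ 8 * L := by
      have := (abs_le.mp (hW y)).2
      nlinarith
    calc |W α L N y ^ 3 - L ^ 3|
        = |W α L N y - L| * (W α L N y ^ 2 + W α L N y * L + L ^ 2) := by
          rw [← abs_of_nonneg (show 0 ≤ W α L N y ^ 2 + W α L N y * L + L ^ 2 by positivity),
            ← abs_mul]
          congr 1
          ring
      _ ≤ 7 * δ * L * ((8 * L) ^ 2 + 8 * L * L + L ^ 2) := by
          gcongr
          exact hW y
      _ = 511 * δ * L ^ 3 := by ring
  have hint : IntervalIntegrable (fun y => W α L N y ^ 3) volume 0 1 := by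
    simp only [W_eq_arcCount]
    exact (((measurable_arcCount (L / N) N).comp
      measurable_prodMk_left).pow_const 3).intervalIntegrable_of_abs_le (C := (N : ℝ) ^ 3)
      (fun y => by rw [abs_pow]; gcongr; exact abs_arcCount_le _ _ _ _) 0 1
  have hdiff : (∫ y in (0:ℝ)..1, (W α L N y) ^ 3) - L ^ 3
      = ∫ y in (0:ℝ)..1, (W α L N y ^ 3 - L ^ 3) := by
    rw [intervalIntegral.integral_sub hint intervalIntegrable_const]
    simp
  rw [hdiff, ← Real.norm_eq_abs]
  refine (intervalIntegral.norm_integral_le_of_norm_le_const fun y _ => hcube y).trans ?_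
  rw [sub_zero, abs_one, mul_one]
  gcongr
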